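/- arXiv:1406.2422 — 3 statements merged into one kernel-verified Lean document; each statement's English description precedes it below -/
import Mathlib

section
/- Fix h > 0 and any ε > 0. If x, y ∈ ℝ satisfy x − y ∈ hℤ, then the spectral distance associated with the h-derivative between the rectangular states satisfies d_{D_h}(δ_{x,ε}, δ_{y,ε}) = |x − y|. -/
open MeasureTheory Filter
open scoped ENNReal

noncomputable section

/-- `f` belongs to `C_0^∞(ℝ, ℝ)` (smooth and vanishing at infinity) and satisfies the norm
condition `‖[D_h, M_f]‖ ≤ 1`, i.e. `sup_t |f(t+h) − f(t)| ≤ h` for the `h`-derivative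
`D_h f(t) = (f(t+h) − f(t))/h`. -/
def hDerivCondition (h : ℝ) (f : ℝ → ℝ) : Prop :=
  ContDiff ℝ (⊤ : ℕ∞) f ∧ Tendsto f (cocompact ℝ) (nhds 0) ∧ ∀ t : ℝ, |f (t + h) - f t| ≤ h

/-- The spectral distance associated with the `h`-derivative between two states
(functionals) `φ` and `ψ` on functions on `ℝ`. -/
def hSpecDist (h : ℝ) (φ ψ : (ℝ → ℝ) → ℝ) : ℝ≥0∞ :=
  ⨆ f : {f : ℝ → ℝ // hDerivCondition h f}, ENNReal.ofReal (φ f.1 - ψ f.1)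

/-- The rectangular state `δ_{x,ε}(f) = (1/ε) ∫_{x−ε/2}^{x+ε/2} f(t) dt`. -/
def rectState (x ε : ℝ) (f : ℝ → ℝ) : ℝ := ε⁻¹ * ∫ t in (x - ε/2)..(x + ε/2), f t

/-- A smooth, `1`-Lipschitz function vanishing at
infinity (for `δ ≠ 0`) which converges to the identity as `δ → 0`. -/
def cutoffId (δ t : ℝ) : ℝ := t / (1 + δ ^ 2 * t ^ 2)

lemma one_add_sq_mul_sq_pos (δ t : ℝ) : 0 < 1 + δ ^ 2 * t ^ 2 := by positivity

lemma continuous_uncurry_cutoffId : Continuous (Function.uncurry cutoffId) := by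
  unfold cutoffId Function.uncurry
  exact Continuous.div (by fun_prop) (by fun_prop) fun p => (one_add_sq_mul_sq_pos p.1 p.2).ne'

lemma contDiff_cutoffId (δ : ℝ) {n : WithTop ℕ∞} : ContDiff ℝ n (cutoffId δ) := by
  unfold cutoffId
  exact ContDiff.div (by fun_prop) (by fun_prop) fun t => (one_add_sq_mul_sq_pos δ t).ne'

lemma tendsto_cutoffId_cocompact {δ : ℝ} (hδ : δ ≠ 0) :
    Tendsto (cutoffId δ) (cocompact ℝ) (nhds 0) := by
  have hinv : Tendsto (fun t : ℝ => t⁻¹) (cocompact ℝ) (nhds 0) := by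
    rw [← Metric.cobounded_eq_cocompact]
    exact tendsto_inv₀_cobounded
  have hquot : Tendsto (fun t : ℝ => t⁻¹ / (t⁻¹ ^ 2 + δ ^ 2)) (cocompact ℝ)
      (nhds (0 / (0 ^ 2 + δ ^ 2))) :=
    hinv.div ((hinv.pow 2).add_const _) (by positivity)
  rw [zero_div] at hquot
  refine hquot.congr fun t => ?_
  have hpos := one_add_sq_mul_sq_pos δ t
  rcases eq_or_ne t 0 with rfl | ht
  · simp [cutoffId]
  · unfold cutoffId
    field_simp

lemma abs_cutoffId_sub_le (δ a b : ℝ) : |cutoffId δ a - cutoffId δ b| ≤ |a - b| := by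
  have ha := one_add_sq_mul_sq_pos δ a
  have hb := one_add_sq_mul_sq_pos δ b
  have hsub : cutoffId δ a - cutoffId δ b =
      (a - b) * ((1 - δ ^ 2 * (a * b)) / ((1 + δ ^ 2 * a ^ 2) * (1 + δ ^ 2 * b ^ 2))) := by
    unfold cutoffId
    field_simp
    ring
  rw [hsub, abs_mul]
  refine mul_le_of_le_one_right (abs_nonneg _) ?_
  rw [abs_div, abs_of_pos (mul_pos ha hb), div_le_one (mul_pos ha hb), abs_le]
  constructor <;>
    nlinarith [sq_nonneg (δ * (a + b)), sq_nonneg (δ * (a - b)), sq_nonneg (δ ^ 2 * (a * b)),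
      sq_nonneg (δ * a), sq_nonneg (δ * b)]

lemma hDerivCondition_const_mul_cutoffId {h δ s : ℝ} (hh : 0 < h) (hδ : δ ≠ 0) (hs : |s| = 1) :
    hDerivCondition h fun t => s * cutoffId δ t := by
  refine ⟨contDiff_const.mul (contDiff_cutoffId δ), ?_, fun t => ?_⟩
  · simpa using (tendsto_cutoffId_cocompact hδ).const_mul s
  · rw [← mul_sub, abs_mul, hs, one_mul]
    simpa [abs_of_pos hh] using abs_cutoffId_sub_le δ (t + h) t

lemma rectState_const_mul (x ε s : ℝ) (f : ℝ → ℝ) :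
    rectState x ε (fun t => s * f t) = s * rectState x ε f := by
  simp only [rectState, intervalIntegral.integral_const_mul]
  ring

lemma rectState_cutoffId_zero {ε : ℝ} (hε : ε ≠ 0) (x : ℝ) :
    rectState x ε (cutoffId 0) = x := by
  simp [rectState, cutoffId]
  field_simp
  ring

lemma continuous_rectState_cutoffId (x ε : ℝ) :
    Continuous fun δ => rectState x ε (cutoffId δ) := by
  unfold rectState
  exact continuous_const.mul
    (intervalIntegral.continuous_parametric_intervalIntegral_of_continuous'
      continuous_uncurry_cutoffId _ _)

lemma abs_apply_add_nat_mul_sub_le {h : ℝ} {f : ℝ → ℝ} (hf : ∀ t, |f (t + h) - f t| ≤ h)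
    (n : ℕ) (t : ℝ) : |f (t + n * h) - f t| ≤ n * h := by
  induction n with
  | zero => simp
  | succ n ih =>
    have hstep := hf (t + n * h)
    rw [show t + ((n + 1 : ℕ) : ℝ) * h = t + n * h + h by push_cast; ring]
    calc |f (t + n * h + h) - f t|
        ≤ |f (t + n * h + h) - f (t + n * h)| + |f (t + n * h) - f t| := abs_sub_le _ _ _
      _ ≤ ((n + 1 : ℕ) : ℝ) * h := by push_cast; linarith

lemma abs_apply_add_int_mul_sub_le {h : ℝ} {f : ℝ → ℝ} (hf : ∀ t, |f (t + h) - f t| ≤ h)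
    (n : ℤ) (t : ℝ) : |f (t + n * h) - f t| ≤ |(n : ℝ)| * h := by
  obtain ⟨m, rfl | rfl⟩ := n.eq_nat_or_neg
  · simpa using abs_apply_add_nat_mul_sub_le hf m t
  · have hm := abs_apply_add_nat_mul_sub_le hf m (t - m * h)
    rw [sub_add_cancel, abs_sub_comm] at hm
    simpa [← sub_eq_add_neg] using hm

lemma rectState_sub_le_of_forall_abs_sub_le {ε : ℝ} (hε : 0 < ε) {x y C : ℝ} {f : ℝ → ℝ}
    (hf : Continuous f) (hC : ∀ t, |f (t + (x - y)) - f t| ≤ C) :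
    rectState x ε f - rectState y ε f ≤ C := by
  have hshift : ∫ t in (x - ε / 2)..(x + ε / 2), f t =
      ∫ t in (y - ε / 2)..(y + ε / 2), f (t + (x - y)) := by
    rw [intervalIntegral.integral_comp_add_right]
    congr 1 <;> ring
  have hshift_cont : Continuous fun t => f (t + (x - y)) := by fun_prop
  have hbound := intervalIntegral.norm_integral_le_of_norm_le_const
    (f := fun t => f (t + (x - y)) - f t) (a := y - ε / 2) (b := y + ε / 2) fun t _ => hC t
  rw [show y + ε / 2 - (y - ε / 2) = ε by ring, abs_of_pos hε,
    intervalIntegral.integral_sub (hshift_cont.intervalIntegrable _ _)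
      (hf.intervalIntegrable _ _)] at hbound
  rw [rectState, rectState, ← mul_sub, hshift, inv_mul_le_iff₀ hε, mul_comm]
  exact (le_abs_self _).trans hbound

/-- For any width `ε > 0`, if `x − y ∈ hℤ` then the spectral distance associated with the
`h`-derivative between the rectangular states `δ_{x,ε}` and `δ_{y,ε}` is `|x − y|`. -/
theorem hSpecDist_rectState_eq_of_mem_orbit {h ε : ℝ} (hh : 0 < h) (hε : 0 < ε) {x y : ℝ}
    (hxy : ∃ n : ℤ, x - y = n * h) :
    hSpecDist h (rectState x ε) (rectState y ε) = ENNReal.ofReal |x - y| := by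
  apply le_antisymm
  · obtain ⟨n, hn⟩ := hxy
    refine iSup_le fun f => ENNReal.ofReal_le_ofReal ?_
    refine rectState_sub_le_of_forall_abs_sub_le hε f.2.1.continuous fun t => ?_
    rw [hn, abs_mul, abs_of_pos hh]
    exact abs_apply_add_int_mul_sub_le f.2.2.2 n t
  · obtain ⟨s, hs, hsxy⟩ : ∃ s : ℝ, |s| = 1 ∧ s * (x - y) = |x - y| := by
      rcases abs_choice (x - y) with habs | habs
      · exact ⟨1, by simp, by simp [habs]⟩
      · exact ⟨-1, by simp, by rw [habs]; ring⟩
    have hcont : Continuous fun δ =>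
        ENNReal.ofReal (s * (rectState x ε (cutoffId δ) - rectState y ε (cutoffId δ))) :=
      ENNReal.continuous_ofReal.comp (continuous_const.mul
        ((continuous_rectState_cutoffId x ε).sub (continuous_rectState_cutoffId y ε)))
    have hlim := (hcont.tendsto 0).mono_left (nhdsWithin_le_nhds (s := {0}ᶜ))
    rw [rectState_cutoffId_zero hε.ne', rectState_cutoffId_zero hε.ne', hsxy] at hlim
    refine le_of_tendsto hlim ?_
    filter_upwards [self_mem_nhdsWithin] with δ hδ
    rw [mul_sub, ← rectState_const_mul, ← rectState_const_mul]
    exact le_iSup (fun f : {f : ℝ → ℝ // hDerivCondition h f} =>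
      ENNReal.ofReal (rectState x ε f.1 - rectState y ε f.1))
      ⟨_, hDerivCondition_const_mul_cutoffId hh hδ hs⟩

end
end

section
/- Fix h > 0 and ε > 0. Let ψ : ℝ → [0,∞) be an integrable function supported in [−ε/2, ε/2] with ∫ψ(t)dt = 1, and for x ∈ ℝ define the state Ψ_x(f) = ∫_{−ε/2}^{ε/2} ψ(t) f(t+x) dt. If x − y ∈ hℤ, then the spectral distance associated with the h-derivative satisfies d_{D_h}(Ψ_x, Ψ_y) = |x − y|, for any value of ε. -/
open MeasureTheory Filter
open scoped ENNReal

noncomputable section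

/-- A translation by an integer multiple of `h` changes an admissible function by at most the
length of the translation. -/
lemma hDerivCondition.abs_add_int_mul_sub_le {h : ℝ} {f : ℝ → ℝ} (hf : hDerivCondition h f)
    (n : ℤ) (t : ℝ) : |f (t + n * h) - f t| ≤ |(n : ℝ)| * h := by
  have hnat : ∀ (m : ℕ) (t : ℝ), |f (t + m * h) - f t| ≤ m * h := by
    intro m
    induction m with
    | zero => intro t; simp
    | succ m ih =>
      intro t
      have hstep := hf.2.2 (t + m * h)
      have htri := abs_sub_le (f (t + m * h + h)) (f (t + m * h)) (f t)
      have hpoint : t + ((m + 1 : ℕ) : ℝ) * h = t + m * h + h := by push_cast; ring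
      rw [hpoint]
      push_cast
      linarith [ih t]
  obtain ⟨m, rfl | rfl⟩ := n.eq_nat_or_neg
  · simpa using hnat m t
  · have hm := hnat m (t + ((-(m : ℤ) : ℤ) : ℝ) * h)
    rw [abs_sub_comm] at hm
    simpa using hm

/-- A smooth approximation of the identity map by functions vanishing at infinity. -/
def dampedId (δ s : ℝ) : ℝ := s / (1 + δ * s ^ 2)

lemma abs_dampedId_sub_le {δ : ℝ} (hδ : 0 < δ) (a b : ℝ) :
    |dampedId δ a - dampedId δ b| ≤ |a - b| := by
  have ha : 0 < 1 + δ * a ^ 2 := by positivity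
  have hb : 0 < 1 + δ * b ^ 2 := by positivity
  have hdiff : dampedId δ a - dampedId δ b =
      (a - b) * ((1 - δ * (a * b)) / ((1 + δ * a ^ 2) * (1 + δ * b ^ 2))) := by
    unfold dampedId
    field_simp
    ring
  have hfactor : |(1 - δ * (a * b)) / ((1 + δ * a ^ 2) * (1 + δ * b ^ 2))| ≤ 1 := by
    rw [abs_div, abs_of_pos (mul_pos ha hb), div_le_one (mul_pos ha hb), abs_le]
    have hsq : 0 ≤ δ ^ 2 * (a * b) ^ 2 := by positivity
    have hsub : 0 ≤ δ * (a - b) ^ 2 := by positivity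
    have hadd : 0 ≤ δ * (a + b) ^ 2 := by positivity
    have hsa : 0 ≤ δ * a ^ 2 := by positivity
    have hsb : 0 ≤ δ * b ^ 2 := by positivity
    constructor <;> nlinarith
  rw [hdiff, abs_mul]
  exact mul_le_of_le_one_right (abs_nonneg _) hfactor

lemma contDiff_dampedId {δ : ℝ} (hδ : 0 < δ) : ContDiff ℝ (⊤ : ℕ∞) (dampedId δ) := by
  refine contDiff_id.div (by fun_prop) fun s => ?_
  have : 0 < 1 + δ * s ^ 2 := by positivity
  exact this.ne'

lemma tendsto_dampedId_cocompact {δ : ℝ} (hδ : 0 < δ) :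
    Tendsto (dampedId δ) (cocompact ℝ) (nhds 0) := by
  have hbound : ∀ s : ℝ, ‖dampedId δ s‖ ≤ δ⁻¹ * ‖s‖⁻¹ := by
    intro s
    rcases eq_or_ne s 0 with rfl | hs
    · simp [dampedId]
    have hs' : 0 < |s| := abs_pos.mpr hs
    have hden : 0 < 1 + δ * s ^ 2 := by positivity
    rw [dampedId, norm_div, Real.norm_eq_abs, Real.norm_eq_abs, abs_of_pos hden, ← mul_inv,
      div_le_iff₀ hden, ← sq_abs s]
    field_simp
    linarith
  refine squeeze_zero_norm hbound ?_
  have := (tendsto_inv_atTop_zero.comp (tendsto_norm_cocompact_atTop (E := ℝ))).const_mul δ⁻¹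
  simpa using this

lemma tendsto_dampedId_nhds_zero (s : ℝ) :
    Tendsto (fun δ => dampedId δ s) (nhdsWithin 0 (Set.Ioi 0)) (nhds s) := by
  have hcont : ContinuousAt (fun δ => dampedId δ s) 0 := by
    unfold dampedId
    exact ContinuousAt.div (by fun_prop) (by fun_prop) (by simp)
  have := hcont.tendsto.mono_left (nhdsWithin_le_nhds (s := Set.Ioi 0))
  simpa [dampedId] using this

lemma hDerivCondition_const_mul_dampedId {h δ c : ℝ} (hh : 0 < h) (hδ : 0 < δ) (hc : |c| = 1) :
    hDerivCondition h (fun s => c * dampedId δ s) := by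
  refine ⟨contDiff_const.mul (contDiff_dampedId hδ), ?_, fun t => ?_⟩
  · simpa using (tendsto_dampedId_cocompact hδ).const_mul c
  · rw [← mul_sub, abs_mul, hc, one_mul]
    refine (abs_dampedId_sub_le hδ _ _).trans ?_
    rw [add_sub_cancel_left, abs_of_pos hh]

/-- The difference of the values of two translated density states on a continuous function. -/
lemma integral_mul_translate_sub {ψ f : ℝ → ℝ} (hψ : Integrable ψ) (hf : Continuous f)
    (a b x y : ℝ) :
    (∫ t in a..b, ψ t * f (t + x)) - (∫ t in a..b, ψ t * f (t + y)) =
      ∫ t in a..b, ψ t * (f (t + x) - f (t + y)) := by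
  have hint : ∀ z : ℝ, IntervalIntegrable (fun t => ψ t * f (t + z)) volume a b := fun z =>
    hψ.intervalIntegrable.mul_continuousOn (by fun_prop)
  rw [← intervalIntegral.integral_sub (hint x) (hint y)]
  simp only [mul_sub]

lemma intervalIntegral_eq_one_of_support_subset {a b : ℝ} (hab : a ≤ b) {ψ : ℝ → ℝ}
    (hsupp : Function.support ψ ⊆ Set.Icc a b) (hnorm : ∫ t, ψ t = 1) :
    ∫ t in a..b, ψ t = 1 := by
  rw [intervalIntegral.integral_of_le hab, ← integral_Icc_eq_integral_Ioc,
    setIntegral_eq_integral_of_forall_compl_eq_zero, hnorm]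
  intro t ht
  by_contra hne
  exact ht (hsupp hne)

/-- For any `ε > 0` and any probability density `ψ` supported in `[−ε/2, ε/2]`, if
`x − y ∈ hℤ` then the spectral distance associated with the `h`-derivative between the
states `Ψ_x(f) = ∫ ψ(t) f(t+x) dt` and `Ψ_y` is `|x − y|`. -/
theorem hSpecDist_densityState_eq_of_mem_orbit {h ε : ℝ} (hh : 0 < h) (hε : 0 < ε)
    (ψ : ℝ → ℝ) (hψint : Integrable ψ) (hψpos : ∀ t, 0 ≤ ψ t)
    (hψsupp : Function.support ψ ⊆ Set.Icc (-(ε/2)) (ε/2))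
    (hψnorm : ∫ t, ψ t = 1) {x y : ℝ}
    (hxy : ∃ n : ℤ, x - y = n * h) :
    hSpecDist h (fun f => ∫ t in (-(ε/2))..(ε/2), ψ t * f (t + x))
        (fun f => ∫ t in (-(ε/2))..(ε/2), ψ t * f (t + y)) =
      ENNReal.ofReal |x - y| := by
  have hab : -(ε / 2) ≤ ε / 2 := by linarith
  have hone := intervalIntegral_eq_one_of_support_subset hab hψsupp hψnorm
  have hψconst : ∀ c : ℝ, ∫ t in (-(ε / 2))..(ε / 2), ψ t * c = c := fun c => by
    rw [intervalIntegral.integral_mul_const, hone, one_mul]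
  apply le_antisymm
  · refine iSup_le fun ⟨f, hf⟩ => ENNReal.ofReal_le_ofReal ?_
    obtain ⟨n, hn⟩ := hxy
    rw [integral_mul_translate_sub hψint hf.1.continuous]
    have hcont := hf.1.continuous
    refine (intervalIntegral.integral_mono_on hab
      (hψint.intervalIntegrable.mul_continuousOn (by fun_prop))
      (hψint.intervalIntegrable.mul_const |x - y|) fun t _ => ?_).trans_eq (hψconst _)
    refine mul_le_mul_of_nonneg_left ((le_abs_self _).trans ?_) (hψpos t)
    have hmove := hf.abs_add_int_mul_sub_le n (t + y)
    rwa [← hn, show t + y + (x - y) = t + x by ring, ← abs_of_pos hh, ← abs_mul,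
      ← hn] at hmove
  · obtain ⟨c, hc, hcxy⟩ : ∃ c : ℝ, |c| = 1 ∧ c * (x - y) = |x - y| := by
      rcases le_total 0 (x - y) with hpos | hneg
      · exact ⟨1, by simp, by rw [abs_of_nonneg hpos, one_mul]⟩
      · exact ⟨-1, by simp, by rw [abs_of_nonpos hneg, neg_one_mul]⟩
    have hlim : Tendsto (fun δ => ∫ t in (-(ε / 2))..(ε / 2),
        ψ t * (c * dampedId δ (t + x) - c * dampedId δ (t + y)))
        (nhdsWithin 0 (Set.Ioi 0)) (nhds |x - y|) := by
      rw [← hψconst |x - y|]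
      refine intervalIntegral.tendsto_integral_filter_of_dominated_convergence
        (fun t => ψ t * |x - y|) ?_ ?_ (hψint.intervalIntegrable.mul_const _) ?_
      · filter_upwards [self_mem_nhdsWithin] with δ hδ
        have hcont := (contDiff_dampedId hδ).continuous
        exact hψint.aestronglyMeasurable.restrict.mul
          (by fun_prop : Continuous fun t =>
            c * dampedId δ (t + x) - c * dampedId δ (t + y)).aestronglyMeasurable
      · filter_upwards [self_mem_nhdsWithin] with δ hδ
        refine Eventually.of_forall fun t _ => ?_
        rw [norm_mul, Real.norm_of_nonneg (hψpos t), ← mul_sub, norm_mul, Real.norm_eq_abs c, hc,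
          one_mul]
        refine mul_le_mul_of_nonneg_left ((abs_dampedId_sub_le hδ _ _).trans_eq ?_) (hψpos t)
        rw [add_sub_add_left_eq_sub]
      · refine Eventually.of_forall fun t _ => Tendsto.const_mul _ ?_
        have hpoint := ((tendsto_dampedId_nhds_zero (t + x)).const_mul c).sub
          ((tendsto_dampedId_nhds_zero (t + y)).const_mul c)
        rwa [← mul_sub, add_sub_add_left_eq_sub, hcxy] at hpoint
    refine le_of_tendsto (ENNReal.tendsto_ofReal hlim) ?_
    filter_upwards [self_mem_nhdsWithin] with δ hδ
    have hadm := hDerivCondition_const_mul_dampedId hh hδ hc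
    rw [← integral_mul_translate_sub hψint hadm.1.continuous]
    exact le_iSup (fun f : {f : ℝ → ℝ // hDerivCondition h f} => ENNReal.ofReal
      ((∫ t in (-(ε / 2))..(ε / 2), ψ t * f.1 (t + x)) -
        ∫ t in (-(ε / 2))..(ε / 2), ψ t * f.1 (t + y))) ⟨_, hadm⟩

end
end

section
/- Fix 0 < q < 1. For any distinct x, y ∈ ℝ, the spectral distance associated with the q-derivative satisfies √q·|x − y| ≤ d_{D_q}(x,y) ≤ √q·(|x| + |y|); in particular it is bounded above by √q times the French railway metric d_SNCF(x,y) = |x| + |y| (for x ≠ y), and is always finite. -/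
open MeasureTheory Filter
open scoped ENNReal

noncomputable section

/-- The spectral distance on `ℝ` associated with the `q`-derivative: the supremum of
`f x − f y` over smooth functions `f` vanishing at infinity satisfying the norm condition
`‖[D_q, M_f]‖ ≤ 1`, i.e. `|f(t) − f(qt)| ≤ √q·(1−q)·|t|` for all `t`. -/
def qSpecDist (q : ℝ) (x y : ℝ) : ℝ≥0∞ :=
  ⨆ f : {f : ℝ → ℝ // ContDiff ℝ (⊤ : ℕ∞) f ∧ Tendsto f (cocompact ℝ) (nhds 0) ∧
      ∀ t : ℝ, |f t - f (q * t)| ≤ Real.sqrt q * (1 - q) * |t|},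
    ENNReal.ofReal (f.1 x - f.1 y)

/-- A function meeting the norm condition of `qSpecDist` stays within `√q·|t|` of its value
at the origin. -/
theorem abs_sub_zero_le_of_qDeriv_bound {q : ℝ} (hq0 : 0 < q) (hq1 : q < 1) {f : ℝ → ℝ}
    (hf : ContinuousAt f 0)
    (hb : ∀ t : ℝ, |f t - f (q * t)| ≤ Real.sqrt q * (1 - q) * |t|) (t : ℝ) :
    |f t - f 0| ≤ Real.sqrt q * |t| := by
  have hpow : Tendsto (fun n : ℕ => q ^ n) atTop (nhds 0) :=
    tendsto_pow_atTop_nhds_zero_of_lt_one hq0.le hq1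
  have hbound : ∀ n : ℕ, |f t - f (q ^ n * t)| ≤ Real.sqrt q * (1 - q ^ n) * |t| := by
    intro n
    induction n with
    | zero => simp
    | succ n ih =>
      have hstep := hb (q ^ n * t)
      rw [abs_mul, abs_of_pos (pow_pos hq0 n), ← mul_assoc q, ← pow_succ'] at hstep
      calc |f t - f (q ^ (n + 1) * t)|
          ≤ |f t - f (q ^ n * t)| + |f (q ^ n * t) - f (q ^ (n + 1) * t)| := abs_sub_le _ _ _
        _ ≤ Real.sqrt q * (1 - q ^ n) * |t| + Real.sqrt q * (1 - q) * (q ^ n * |t|) :=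
            add_le_add ih hstep
        _ = Real.sqrt q * (1 - q ^ (n + 1)) * |t| := by ring
  have hleft : Tendsto (fun n : ℕ => |f t - f (q ^ n * t)|) atTop (nhds |f t - f 0|) := by
    have harg : Tendsto (fun n : ℕ => q ^ n * t) atTop (nhds 0) := by
      simpa using hpow.mul_const t
    exact (tendsto_const_nhds.sub (hf.tendsto.comp harg)).abs
  have hright : Tendsto (fun n : ℕ => Real.sqrt q * (1 - q ^ n) * |t|) atTop
      (nhds (Real.sqrt q * |t|)) := by
    simpa using ((hpow.const_sub 1).const_mul (Real.sqrt q)).mul_const |t|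
  exact le_of_tendsto_of_tendsto' hleft hright hbound

/-- The map `s ↦ s / (1 + ε s²)` is `1`-Lipschitz for `0 ≤ ε`. -/
theorem abs_div_one_add_mul_sq_sub_le {ε : ℝ} (hε : 0 ≤ ε) (a b : ℝ) :
    |a / (1 + ε * a ^ 2) - b / (1 + ε * b ^ 2)| ≤ |a - b| := by
  have ha : 0 < 1 + ε * a ^ 2 := by positivity
  have hb : 0 < 1 + ε * b ^ 2 := by positivity
  have heq : a / (1 + ε * a ^ 2) - b / (1 + ε * b ^ 2) =
      (a - b) * ((1 - ε * (a * b)) / ((1 + ε * a ^ 2) * (1 + ε * b ^ 2))) := by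
    field_simp
    ring
  rw [heq, abs_mul]
  refine mul_le_of_le_one_right (abs_nonneg _) ?_
  rw [abs_div, abs_of_pos (mul_pos ha hb), div_le_one (mul_pos ha hb), abs_le]
  have hsq : 0 ≤ ε ^ 2 * (a ^ 2 * b ^ 2) := by positivity
  have hsub : 0 ≤ ε * (a - b) ^ 2 := by positivity
  have hadd : 0 ≤ ε * (a + b) ^ 2 := by positivity
  have hasq : 0 ≤ ε * a ^ 2 := by positivity
  have hbsq : 0 ≤ ε * b ^ 2 := by positivity
  constructor <;> nlinarith

/-- The map `s ↦ s / (1 + ε s²)` vanishes at infinity for `0 < ε`. -/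
theorem tendsto_div_one_add_mul_sq_cocompact {ε : ℝ} (hε : 0 < ε) :
    Tendsto (fun s : ℝ => s / (1 + ε * s ^ 2)) (cocompact ℝ) (nhds 0) := by
  have hinv : Tendsto (fun s : ℝ => ε⁻¹ * ‖s‖⁻¹) (cocompact ℝ) (nhds 0) := by
    simpa using (tendsto_inv_atTop_zero.comp
      (tendsto_norm_cocompact_atTop (E := ℝ))).const_mul ε⁻¹
  refine squeeze_zero_norm (fun s => ?_) hinv
  rcases eq_or_ne s 0 with rfl | hs
  · simp
  have hden : 0 < 1 + ε * s ^ 2 := by positivity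
  rw [Real.norm_eq_abs, Real.norm_eq_abs, abs_div, abs_of_pos hden, ← mul_inv, ← one_div,
    div_le_div_iff₀ hden (by positivity)]
  nlinarith [sq_abs s]

/-- A lower bound for the spectral distance from the test function
`t ↦ √q·c·(t - y) / (1 + ε (t - y)²)`. -/
theorem ofReal_le_qSpecDist {q : ℝ} (hq1 : q < 1) {ε c : ℝ} (hε : 0 < ε)
    (hc : |c| ≤ 1) (x y : ℝ) :
    ENNReal.ofReal (Real.sqrt q * c * ((x - y) / (1 + ε * (x - y) ^ 2))) ≤ qSpecDist q x y := by
  let f : ℝ → ℝ := fun t => Real.sqrt q * c * ((t - y) / (1 + ε * (t - y) ^ 2))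
  have hsmooth : ContDiff ℝ (⊤ : ℕ∞) f := by
    refine contDiff_const.mul (ContDiff.div (by fun_prop) (by fun_prop) fun t => ?_)
    positivity
  have hvanish : Tendsto f (cocompact ℝ) (nhds 0) := by
    simpa [f, Function.comp_def] using ((tendsto_div_one_add_mul_sq_cocompact hε).comp
      (Homeomorph.subRight y).isClosedEmbedding.tendsto_cocompact).const_mul (Real.sqrt q * c)
  have hbound : ∀ t : ℝ, |f t - f (q * t)| ≤ Real.sqrt q * (1 - q) * |t| := by
    intro t
    have hlip := abs_div_one_add_mul_sq_sub_le hε.le (t - y) (q * t - y)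
    have hdiff : |t - y - (q * t - y)| = (1 - q) * |t| := by
      rw [← abs_of_pos (sub_pos.mpr hq1), ← abs_mul]
      ring_nf
    rw [hdiff] at hlip
    simp only [f]
    rw [← mul_sub, abs_mul, abs_mul, abs_of_nonneg (Real.sqrt_nonneg q), mul_assoc, mul_assoc]
    refine mul_le_mul_of_nonneg_left ?_ (Real.sqrt_nonneg q)
    exact (mul_le_of_le_one_left (abs_nonneg _) hc).trans hlip
  have hsup := le_iSup (fun f : {f : ℝ → ℝ // ContDiff ℝ (⊤ : ℕ∞) f ∧
      Tendsto f (cocompact ℝ) (nhds 0) ∧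
      ∀ t : ℝ, |f t - f (q * t)| ≤ Real.sqrt q * (1 - q) * |t|} =>
    ENNReal.ofReal (f.1 x - f.1 y)) ⟨f, hsmooth, hvanish, hbound⟩
  simpa [f, qSpecDist] using hsup

/-- For `0 < q < 1` and distinct points `x ≠ y`, the spectral distance associated with the
`q`-derivative satisfies `√q·|x − y| ≤ d_{D_q}(x,y) ≤ √q·(|x| + |y|)`; in particular it is
bounded above by `√q` times the French railway metric and is always finite. -/
theorem qSpecDist_bounds {q : ℝ} (hq0 : 0 < q) (hq1 : q < 1) {x y : ℝ} (hxy : x ≠ y) :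
    ENNReal.ofReal (Real.sqrt q * |x - y|) ≤ qSpecDist q x y ∧
    qSpecDist q x y ≤ ENNReal.ofReal (Real.sqrt q * (|x| + |y|)) ∧
    qSpecDist q x y ≠ ⊤ := by
  have hupper : qSpecDist q x y ≤ ENNReal.ofReal (Real.sqrt q * (|x| + |y|)) := by
    refine iSup_le fun ⟨f, hf, _, hb⟩ => ENNReal.ofReal_le_ofReal ?_
    have hx := abs_le.mp
      (abs_sub_zero_le_of_qDeriv_bound hq0 hq1 hf.continuous.continuousAt hb x)
    have hy := abs_le.mp
      (abs_sub_zero_le_of_qDeriv_bound hq0 hq1 hf.continuous.continuousAt hb y)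
    linarith [hx.2, hy.1]
  refine ⟨?_, hupper, ne_top_of_le_ne_top ENNReal.ofReal_ne_top hupper⟩
  obtain ⟨c, hc, hcxy⟩ : ∃ c : ℝ, |c| ≤ 1 ∧ c * (x - y) = |x - y| := by
    rcases lt_or_gt_of_ne hxy with h | h
    · exact ⟨-1, by simp, by rw [abs_of_neg (sub_neg.mpr h)]; ring⟩
    · exact ⟨1, by simp, by rw [abs_of_pos (sub_pos.mpr h)]; ring⟩
  have hcont : ContinuousAt
      (fun ε : ℝ => Real.sqrt q * c * ((x - y) / (1 + ε * (x - y) ^ 2))) 0 := by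
    refine continuousAt_const.mul (ContinuousAt.div (by fun_prop) (by fun_prop) ?_)
    simp
  have hlim : Tendsto
      (fun ε : ℝ => ENNReal.ofReal (Real.sqrt q * c * ((x - y) / (1 + ε * (x - y) ^ 2))))
      (nhdsWithin 0 (Set.Ioi 0)) (nhds (ENNReal.ofReal (Real.sqrt q * |x - y|))) := by
    refine ENNReal.tendsto_ofReal ?_
    simpa [mul_assoc, hcxy] using hcont.tendsto.mono_left nhdsWithin_le_nhds
  refine le_of_tendsto hlim ?_
  filter_upwards [self_mem_nhdsWithin] with ε hε
  exact ofReal_le_qSpecDist hq1 hε hc x y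

end
end
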